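/- Let M : ℝˢ ⇒ ℝᵈ be a multifunction and (x̄,ȳ) ∈ gph M. (i) The following hold: M is metrically regular around (x̄,ȳ) if and only if M is metrically regular in direction (0,0) at (x̄,ȳ), and either of these implies that M is metrically regular in every direction (u,v) ≠ (0,0) at (x̄,ȳ). (ii) The following are equivalent: M is metrically subregular at (x̄,ȳ); M is metrically subregular in direction 0 at (x̄,ȳ); M is metrically subregular in every direction u ≠ 0 at (x̄,ȳ). (iii) If M is metrically regular in direction (u,0) at (x̄,ȳ), then M is metrically subregular in direction u at (x̄,ȳ). -/

import Mathlib

open Filter Topology Metric Set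
open scoped RealInnerProductSpace

noncomputable section

abbrev Es (k : ℕ) : Type := EuclideanSpace ℝ (Fin k)

/-- Graph of a multifunction. -/
def gph {E F : Type*} (M : E → Set F) : Set (E × F) := {z | z.2 ∈ M z.1}

/-- `M` is metrically regular around `(xb, yb)` (with the convention that the distance
to the empty set is `+∞`). -/
def MetrRegAround {E F : Type*} [NormedAddCommGroup E] [NormedAddCommGroup F]
    (M : E → Set F) (xb : E) (yb : F) : Prop :=
  ∃ κ : ℝ, 0 ≤ κ ∧ ∃ ε : ℝ, 0 < ε ∧ ∀ x y, dist x xb < ε → dist y yb < ε →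
    EMetric.infEdist x {x' | y ∈ M x'} ≤ ENNReal.ofReal κ * EMetric.infEdist y (M x)

/-- `M` is metrically subregular at `(xb, yb)`. -/
def MetrSubregAt {E F : Type*} [NormedAddCommGroup E] [NormedAddCommGroup F]
    (M : E → Set F) (xb : E) (yb : F) : Prop :=
  ∃ κ : ℝ, 0 ≤ κ ∧ ∃ ε : ℝ, 0 < ε ∧ ∀ x, dist x xb < ε →
    EMetric.infEdist x {x' | yb ∈ M x'} ≤ ENNReal.ofReal κ * EMetric.infEdist yb (M x)

/-- `M` is metrically regular in direction `(u, v)` at `(xb, yb)`. -/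
def DirMetrRegAt {E F : Type*} [NormedAddCommGroup E] [NormedSpace ℝ E]
    [NormedAddCommGroup F] [NormedSpace ℝ F]
    (M : E → Set F) (xb : E) (yb : F) (u : E) (v : F) : Prop :=
  ∃ δ : ℝ, 0 < δ ∧ ∃ κ : ℝ, 0 < κ ∧ ∀ t ∈ Icc (0:ℝ) δ, ∀ (u' : E) (v' : F),
    dist (u', v') (u, v) ≤ δ →
    EMetric.infEdist (xb + t • u', yb + t • v') (gph M) ≤ ENNReal.ofReal (δ * t) →
    EMetric.infEdist (xb + t • u') {x | yb + t • v' ∈ M x} ≤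
      ENNReal.ofReal κ * EMetric.infEdist (yb + t • v') (M (xb + t • u'))

/-- `M` is metrically subregular in direction `u` at `(xb, yb)`. -/
def DirMetrSubregAt {E F : Type*} [NormedAddCommGroup E] [NormedSpace ℝ E]
    [NormedAddCommGroup F] [NormedSpace ℝ F]
    (M : E → Set F) (xb : E) (yb : F) (u : E) : Prop :=
  ∃ δ : ℝ, 0 < δ ∧ ∃ κ : ℝ, 0 < κ ∧ ∀ t ∈ Icc (0:ℝ) δ, ∀ u' : E, dist u' u ≤ δ →
    EMetric.infEdist (xb + t • u') {x | yb ∈ M x} ≤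
      ENNReal.ofReal κ * EMetric.infEdist yb (M (xb + t • u'))

theorem infEDist_gph_le {E F : Type*} [NormedAddCommGroup E]
    [NormedAddCommGroup F] (M : E → Set F) (x : E) (y : F) :
    infEDist (x, y) (gph M) ≤ infEDist y (M x) := by
  refine le_infEDist.2 fun y' hy' => ?_
  refine (infEDist_le_edist_of_mem (y := (x, y')) hy').trans ?_
  simp [Prod.edist_eq]

section DirectionalRegularity

variable {E F : Type*} [NormedAddCommGroup E] [NormedSpace ℝ E]
  [NormedAddCommGroup F] [NormedSpace ℝ F] {M : E → Set F} {xb : E} {yb : F}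

theorem ENNReal.le_ofReal_mul_of_le {a b : ENNReal} {κ κ' : ℝ} (h : κ ≤ κ')
    (hab : a ≤ ENNReal.ofReal κ * b) : a ≤ ENNReal.ofReal κ' * b :=
  hab.trans (by gcongr)

theorem exists_pos_mul_add_lt (c : ℝ) (hc : 0 ≤ c) {ε : ℝ} (hε : 0 < ε) :
    ∃ δ : ℝ, 0 < δ ∧ δ * (c + δ) < ε := by
  refine ⟨min 1 (ε / (2 * (c + 1))), by positivity, ?_⟩
  have h1 : min 1 (ε / (2 * (c + 1))) ≤ 1 := min_le_left _ _
  calc min 1 (ε / (2 * (c + 1))) * (c + min 1 (ε / (2 * (c + 1))))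
      ≤ ε / (2 * (c + 1)) * (c + 1) := by
        gcongr
        exact min_le_right _ _
    _ = ε / 2 := by field_simp
    _ < ε := by linarith

theorem dist_add_smul_lt {G : Type*} [NormedAddCommGroup G] [NormedSpace ℝ G] (x : G)
    {w w' : G} {t δ c ε : ℝ} (ht : t ∈ Icc 0 δ) (hw : ‖w‖ ≤ c) (hw' : dist w' w ≤ δ)
    (hδ : δ * (c + δ) < ε) : dist (x + t • w') x < ε := by
  have h : ‖w'‖ ≤ c + δ := by
    have := norm_le_norm_add_norm_sub' w' w
    rw [dist_eq_norm] at hw'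
    linarith
  have hδ0 : 0 ≤ δ := ht.1.trans ht.2
  rw [dist_eq_norm, add_sub_cancel_left, norm_smul, Real.norm_of_nonneg ht.1]
  exact (mul_le_mul ht.2 h (norm_nonneg _) hδ0).trans_lt hδ

theorem dist_inv_smul_sub_zero_le {G : Type*} [NormedAddCommGroup G] [NormedSpace ℝ G]
    {x xb : G} {δ : ℝ} (hδ : 0 < δ) (hx : dist x xb < δ * δ) :
    dist (δ⁻¹ • (x - xb)) 0 ≤ δ := by
  rw [dist_zero_right, norm_smul, norm_inv, Real.norm_of_nonneg hδ.le, ← dist_eq_norm,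
    inv_mul_le_iff₀ hδ]
  exact hx.le

theorem MetrRegAround.dirMetrRegAt (h : MetrRegAround M xb yb) (u : E) (v : F) :
    DirMetrRegAt M xb yb u v := by
  obtain ⟨κ, hκ, ε, hε, h⟩ := h
  obtain ⟨δ, hδ, hδε⟩ := exists_pos_mul_add_lt ‖(u, v)‖ (norm_nonneg _) hε
  refine ⟨δ, hδ, κ + 1, by linarith, fun t ht u' v' hd _ => ?_⟩
  rw [Prod.dist_eq, max_le_iff] at hd
  exact ENNReal.le_ofReal_mul_of_le (by linarith) (h _ _
    (dist_add_smul_lt xb ht (norm_fst_le (u, v)) hd.1 hδε)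
    (dist_add_smul_lt yb ht (norm_snd_le (u, v)) hd.2 hδε))

theorem DirMetrRegAt.metrRegAround (hbar : yb ∈ M xb) (h : DirMetrRegAt M xb yb 0 0) :
    MetrRegAround M xb yb := by
  obtain ⟨δ, hδ, κ, hκ, h⟩ := h
  refine ⟨κ, hκ.le, δ * δ, by positivity, fun x y hx hy => ?_⟩
  have key := h δ ⟨hδ.le, le_rfl⟩ (δ⁻¹ • (x - xb)) (δ⁻¹ • (y - yb))
    (max_le (dist_inv_smul_sub_zero_le hδ hx) (dist_inv_smul_sub_zero_le hδ hy))
  simp only [smul_inv_smul₀ hδ.ne', add_sub_cancel] at key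
  refine key ((infEDist_le_edist_of_mem (y := (xb, yb)) hbar).trans ?_)
  rw [edist_dist]
  exact ENNReal.ofReal_le_ofReal (max_le hx.le hy.le)

theorem MetrSubregAt.dirMetrSubregAt (h : MetrSubregAt M xb yb) (u : E) :
    DirMetrSubregAt M xb yb u := by
  obtain ⟨κ, hκ, ε, hε, h⟩ := h
  obtain ⟨δ, hδ, hδε⟩ := exists_pos_mul_add_lt ‖u‖ (norm_nonneg _) hε
  exact ⟨δ, hδ, κ + 1, by linarith, fun t ht u' hd =>
    ENNReal.le_ofReal_mul_of_le (by linarith) (h _ (dist_add_smul_lt xb ht le_rfl hd hδε))⟩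

theorem DirMetrSubregAt.metrSubregAt (h : DirMetrSubregAt M xb yb 0) :
    MetrSubregAt M xb yb := by
  obtain ⟨δ, hδ, κ, hκ, h⟩ := h
  refine ⟨κ, hκ.le, δ * δ, by positivity, fun x hx => ?_⟩
  have key := h δ ⟨hδ.le, le_rfl⟩ (δ⁻¹ • (x - xb)) (dist_inv_smul_sub_zero_le hδ hx)
  simpa only [smul_inv_smul₀ hδ.ne', add_sub_cancel] using key

/-- On a compact set of directions, directional metric subregularity holds with uniform
constants. -/
theorem exists_uniform_of_dirMetrSubregAt {K : Set E} (hK : IsCompact K)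
    (h : ∀ u ∈ K, DirMetrSubregAt M xb yb u) :
    ∃ δ : ℝ, 0 < δ ∧ ∃ κ : ℝ, 0 < κ ∧ ∀ t ∈ Icc (0:ℝ) δ, ∀ u' ∈ K,
      infEDist (xb + t • u') {x | yb ∈ M x} ≤
        ENNReal.ofReal κ * infEDist yb (M (xb + t • u')) := by
  refine hK.induction_on (p := fun S => ∃ δ : ℝ, 0 < δ ∧ ∃ κ : ℝ, 0 < κ ∧
    ∀ t ∈ Icc (0:ℝ) δ, ∀ u' ∈ S, infEDist (xb + t • u') {x | yb ∈ M x} ≤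
      ENNReal.ofReal κ * infEDist yb (M (xb + t • u'))) ?_ ?_ ?_ ?_
  · exact ⟨1, one_pos, 1, one_pos, fun _ _ _ hu => hu.elim⟩
  · rintro S T hST ⟨δ, hδ, κ, hκ, h⟩
    exact ⟨δ, hδ, κ, hκ, fun t ht u' hu' => h t ht u' (hST hu')⟩
  · rintro S T ⟨δ₁, hδ₁, κ₁, hκ₁, h₁⟩ ⟨δ₂, hδ₂, κ₂, hκ₂, h₂⟩
    refine ⟨min δ₁ δ₂, lt_min hδ₁ hδ₂, max κ₁ κ₂, lt_max_of_lt_left hκ₁, ?_⟩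
    rintro t ⟨ht0, ht⟩ u' (hu' | hu')
    · exact ENNReal.le_ofReal_mul_of_le (le_max_left _ _)
        (h₁ t ⟨ht0, ht.trans (min_le_left _ _)⟩ u' hu')
    · exact ENNReal.le_ofReal_mul_of_le (le_max_right _ _)
        (h₂ t ⟨ht0, ht.trans (min_le_right _ _)⟩ u' hu')
  · intro u hu
    obtain ⟨δ, hδ, κ, hκ, h⟩ := h u hu
    exact ⟨closedBall u δ, mem_nhdsWithin_of_mem_nhds (closedBall_mem_nhds u hδ),
      δ, hδ, κ, hκ, fun t ht u' hu' => h t ht u' hu'⟩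

theorem metrSubregAt_of_forall_ne_zero [ProperSpace E] (hbar : yb ∈ M xb)
    (h : ∀ u : E, u ≠ 0 → DirMetrSubregAt M xb yb u) : MetrSubregAt M xb yb := by
  obtain ⟨δ, hδ, κ, hκ, h⟩ := exists_uniform_of_dirMetrSubregAt (isCompact_sphere (0 : E) 1)
    fun u hu => h u (ne_of_mem_sphere hu one_ne_zero)
  refine ⟨κ, hκ.le, δ, hδ, fun x hx => ?_⟩
  obtain rfl | hne := eq_or_ne x xb
  · exact (infEDist_zero_of_mem (s := {x | yb ∈ M x}) hbar).trans_le zero_le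
  have hn : ‖x - xb‖ ≠ 0 := norm_ne_zero_iff.2 (sub_ne_zero.2 hne)
  have key := h ‖x - xb‖ ⟨norm_nonneg _, by rw [← dist_eq_norm]; exact hx.le⟩
    (‖x - xb‖⁻¹ • (x - xb)) (by
      rw [mem_sphere_zero_iff_norm, norm_smul, norm_inv, norm_norm, inv_mul_cancel₀ hn])
  simp only [smul_inv_smul₀ hn, add_sub_cancel] at key
  exact key

theorem DirMetrRegAt.dirMetrSubregAt (hbar : yb ∈ M xb) {u : E}
    (h : DirMetrRegAt M xb yb u 0) : DirMetrSubregAt M xb yb u := by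
  obtain ⟨δ, hδ, κ, hκ, h⟩ := h
  refine ⟨δ, hδ, max κ ((‖u‖ + δ) / δ), lt_max_of_lt_left hκ, fun t ht u' hu' => ?_⟩
  by_cases hg : infEDist (xb + t • u', yb) (gph M) ≤ ENNReal.ofReal (δ * t)
  · have key := h t ht u' 0 (max_le hu' (by simpa using hδ.le))
    simp only [smul_zero, add_zero] at key
    exact ENNReal.le_ofReal_mul_of_le (le_max_left _ _) (key hg)
  · refine ENNReal.le_ofReal_mul_of_le (le_max_right _ _) ?_
    have hn : ‖u'‖ ≤ ‖u‖ + δ := by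
      have := norm_le_norm_add_norm_sub' u' u
      rw [dist_eq_norm] at hu'
      linarith
    calc infEDist (xb + t • u') {x | yb ∈ M x}
        ≤ edist (xb + t • u') xb := infEDist_le_edist_of_mem hbar
      _ ≤ ENNReal.ofReal ((‖u‖ + δ) / δ * (δ * t)) := by
        rw [edist_dist, dist_eq_norm, add_sub_cancel_left, norm_smul,
          Real.norm_of_nonneg ht.1, ← mul_assoc, div_mul_cancel₀ _ hδ.ne', mul_comm]
        exact ENNReal.ofReal_le_ofReal (mul_le_mul_of_nonneg_right hn ht.1)
      _ = ENNReal.ofReal ((‖u‖ + δ) / δ) * ENNReal.ofReal (δ * t) :=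
        ENNReal.ofReal_mul (by positivity)
      _ ≤ ENNReal.ofReal ((‖u‖ + δ) / δ) * infEDist yb (M (xb + t • u')) := by
        gcongr
        exact (not_le.1 hg).le.trans (infEDist_gph_le M _ _)

end DirectionalRegularity

/-- Basic relations between (directional) metric regularity and (directional) metric
subregularity (Lemma `LemBasicPropDirMetr`). -/
theorem stmt8 {s d : ℕ} (M : Es s → Set (Es d)) (xb : Es s) (yb : Es d)
    (hbar : yb ∈ M xb) :
    ((MetrRegAround M xb yb ↔ DirMetrRegAt M xb yb 0 0) ∧
      (DirMetrRegAt M xb yb 0 0 →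
        ∀ (u : Es s) (v : Es d), (u, v) ≠ (0, 0) → DirMetrRegAt M xb yb u v)) ∧
    ((MetrSubregAt M xb yb ↔ DirMetrSubregAt M xb yb 0) ∧
      (DirMetrSubregAt M xb yb 0 ↔ ∀ u : Es s, u ≠ 0 → DirMetrSubregAt M xb yb u)) ∧
    (∀ u : Es s, DirMetrRegAt M xb yb u 0 → DirMetrSubregAt M xb yb u) := by
  refine ⟨⟨⟨fun h => h.dirMetrRegAt 0 0, fun h => h.metrRegAround hbar⟩,
    fun h u v _ => (h.metrRegAround hbar).dirMetrRegAt u v⟩,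
    ⟨⟨fun h => h.dirMetrSubregAt 0, fun h => h.metrSubregAt⟩,
      fun h u _ => h.metrSubregAt.dirMetrSubregAt u,
      fun h => (metrSubregAt_of_forall_ne_zero hbar h).dirMetrSubregAt 0⟩,
    fun u h => h.dirMetrSubregAt hbar⟩
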